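/- Let (Ω, ℱ₂, P) be a probability space with sub-σ-algebra ℱ₁ ⊆ ℱ₂. Then ℱ₂ is atomless conditionally to ℱ₁ if and only if there exists an ℱ₂-measurable random variable U : Ω → [0,1], uniformly distributed on [0,1] and independent of ℱ₁, such that for every ℱ₁-measurable function h : Ω → [0,1] one has E[1_{{U ≤ h}} ∣ ℱ₁] = h almost surely. -/

import Mathlib

open MeasureTheory ProbabilityTheory

/-- The conditional expectation of the indicator of a set, as a real-valued function. -/
noncomputable def condIndicator {Ω : Type*} (m1 : MeasurableSpace Ω) [MeasurableSpace Ω]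
    (μ : Measure Ω) (A : Set Ω) : Ω → ℝ :=
  μ[A.indicator (fun _ => (1 : ℝ)) | m1]

/-- The ambient σ-algebra is atomless conditionally to `m1`: for every measurable set `A`
there is a measurable `B ⊆ A` with `0 < E[1_B ∣ m1] < E[1_A ∣ m1]` a.s. on
`{E[1_A ∣ m1] > 0}`. -/
def CondAtomless {Ω : Type*} (m1 : MeasurableSpace Ω) [MeasurableSpace Ω]
    (μ : Measure Ω) : Prop :=
  ∀ A : Set Ω, MeasurableSet A →
    ∃ B : Set Ω, MeasurableSet B ∧ B ⊆ A ∧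
      ∀ᵐ ω ∂μ, 0 < condIndicator m1 μ A ω →
        0 < condIndicator m1 μ B ω ∧ condIndicator m1 μ B ω < condIndicator m1 μ A ω

/-- Two real random variables are commonotone if both are a.s. equal to nondecreasing
functions of a common random variable. -/
def Commonotone {Ω : Type*} [MeasurableSpace Ω] (μ : Measure Ω) (ξ η : Ω → ℝ) : Prop :=
  ∃ (f g : ℝ → ℝ) (ζ : Ω → ℝ), Monotone f ∧ Monotone g ∧ Measurable ζ ∧
    ξ =ᵐ[μ] (fun ω => f (ζ ω)) ∧ η =ᵐ[μ] (fun ω => g (ζ ω))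

section DyadicChain

variable {Ω : Type*}

/-- The dyadic chain generated by a map `L` selecting a subset of every set: the member of level
`n + 1` halfway between two consecutive members of level `n` adds to the smaller one the part of
their difference selected by `L`. -/
def dyadicChain (L : Set Ω → Set Ω) : ℕ → ℕ → Set Ω
  | 0, k => if k = 0 then ∅ else Set.univ
  | n + 1, k => if k % 2 = 0 then dyadicChain L n (k / 2) else
      dyadicChain L n (k / 2) ∪ L (dyadicChain L n (k / 2 + 1) \ dyadicChain L n (k / 2))

theorem dyadicChain_succ_two_mul (L : Set Ω → Set Ω) (n k : ℕ) :
    dyadicChain L (n + 1) (2 * k) = dyadicChain L n k := by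
  simp [dyadicChain]

theorem dyadicChain_succ_two_mul_add_one (L : Set Ω → Set Ω) (n k : ℕ) :
    dyadicChain L (n + 1) (2 * k + 1) =
      dyadicChain L n k ∪ L (dyadicChain L n (k + 1) \ dyadicChain L n k) := by
  have h1 : (2 * k + 1) % 2 = 1 := by omega
  have h2 : (2 * k + 1) / 2 = k := by omega
  simp [dyadicChain, h1, h2]

theorem monotone_dyadicChain {L : Set Ω → Set Ω} (hL : ∀ A, L A ⊆ A) (n : ℕ) :
    Monotone (dyadicChain L n) := by
  induction n with
  | zero => exact monotone_nat_of_le_succ fun k => by simp [dyadicChain]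
  | succ n ih =>
    refine monotone_nat_of_le_succ fun k => ?_
    obtain ⟨j, rfl | rfl⟩ := k.even_or_odd'
    · rw [dyadicChain_succ_two_mul, dyadicChain_succ_two_mul_add_one]
      exact Set.subset_union_left
    · rw [show 2 * j + 1 + 1 = 2 * (j + 1) by ring, dyadicChain_succ_two_mul,
        dyadicChain_succ_two_mul_add_one]
      exact Set.union_subset (ih j.le_succ) ((hL _).trans Set.sdiff_subset)

theorem dyadicChain_add_pow_mul (L : Set Ω → Set Ω) (n m k : ℕ) :
    dyadicChain L (n + m) (2 ^ m * k) = dyadicChain L n k := by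
  induction m with
  | zero => simp
  | succ m ih => rw [← add_assoc, pow_succ', mul_assoc, dyadicChain_succ_two_mul, ih]

theorem dyadicChain_subset {L : Set Ω → Set Ω} (hL : ∀ A, L A ⊆ A) {n k n' k' : ℕ}
    (h : (k : ℝ) / 2 ^ n ≤ k' / 2 ^ n') : dyadicChain L n k ⊆ dyadicChain L n' k' := by
  rw [div_le_div_iff₀ (by positivity) (by positivity)] at h
  rw [← dyadicChain_add_pow_mul L n n', ← dyadicChain_add_pow_mul L n' n, add_comm n']
  refine monotone_dyadicChain hL _ ?_
  rw [mul_comm, mul_comm (2 ^ n)]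
  exact_mod_cast h

open Classical in
/-- The random variable whose sublevel sets interpolate the dyadic chain generated by `L`. -/
noncomputable def dyadicVar (L : Set Ω → Set Ω) (ω : Ω) : ℝ :=
  ⨅ p : ℕ × ℕ, if ω ∈ dyadicChain L p.1 p.2 then (p.2 : ℝ) / 2 ^ p.1 else 1

theorem bddBelow_dyadicVar (L : Set Ω → Set Ω) (ω : Ω) [∀ A : Set Ω, Decidable (ω ∈ A)] :
    BddBelow (Set.range fun p : ℕ × ℕ =>
      if ω ∈ dyadicChain L p.1 p.2 then (p.2 : ℝ) / 2 ^ p.1 else 1) := by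
  refine ⟨0, ?_⟩
  rintro _ ⟨p, rfl⟩
  dsimp only
  split_ifs <;> positivity

theorem dyadicVar_mem_Icc (L : Set Ω → Set Ω) (ω : Ω) : dyadicVar L ω ∈ Set.Icc (0 : ℝ) 1 := by
  classical
  refine ⟨le_ciInf fun p => ?_, (ciInf_le (bddBelow_dyadicVar L ω) (0, 1)).trans ?_⟩
  · split_ifs <;> positivity
  · simp

theorem dyadicVar_le_of_mem {L : Set Ω → Set Ω} {ω : Ω} {n k : ℕ} (h : ω ∈ dyadicChain L n k) :
    dyadicVar L ω ≤ k / 2 ^ n := by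
  classical
  refine (ciInf_le (bddBelow_dyadicVar L ω) (n, k)).trans ?_
  simp [h]

theorem mem_dyadicChain_of_dyadicVar_lt {L : Set Ω → Set Ω} (hL : ∀ A, L A ⊆ A) {ω : Ω} {n k : ℕ}
    (hk : k ≤ 2 ^ n) (h : dyadicVar L ω < k / 2 ^ n) : ω ∈ dyadicChain L n k := by
  classical
  obtain ⟨p, hp⟩ := exists_lt_of_ciInf_lt h
  split_ifs at hp with hω
  · exact dyadicChain_subset hL hp.le hω
  · rw [lt_div_iff₀ (by positivity), one_mul] at hp
    exact absurd hp (not_lt.2 (by exact_mod_cast hk))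

end DyadicChain

section CondIndicator

variable {Ω : Type*} {m1 : MeasurableSpace Ω} [m2 : MeasurableSpace Ω] {μ : Measure Ω}

theorem stronglyMeasurable_condIndicator (A : Set Ω) :
    StronglyMeasurable[m1] (condIndicator m1 μ A) :=
  stronglyMeasurable_condExp

theorem measurable_condIndicator (A : Set Ω) : Measurable[m1] (condIndicator m1 μ A) :=
  (stronglyMeasurable_condIndicator A).measurable

theorem integrable_condIndicator (A : Set Ω) : Integrable (condIndicator m1 μ A) μ :=
  integrable_condExp

theorem setIntegral_condIndicator [IsFiniteMeasure μ] (hm : m1 ≤ m2) {A S : Set Ω}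
    (hA : MeasurableSet A) (hS : MeasurableSet[m1] S) :
    ∫ ω in S, condIndicator m1 μ A ω ∂μ = μ.real (A ∩ S) := by
  rw [condIndicator, setIntegral_condExp hm ((integrable_const 1).indicator hA) hS,
    integral_indicator hA, Measure.restrict_restrict hA]
  simp

theorem condIndicator_nonneg (A : Set Ω) : 0 ≤ᵐ[μ] condIndicator m1 μ A :=
  condExp_nonneg (.of_forall fun _ => Set.indicator_nonneg (fun _ _ => zero_le_one) _)

theorem condIndicator_univ [IsFiniteMeasure μ] (hm : m1 ≤ m2) :
    condIndicator m1 μ Set.univ = fun _ => 1 := by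
  simp [condIndicator, condExp_const hm]

theorem condIndicator_union [IsFiniteMeasure μ] {A B : Set Ω} (hA : MeasurableSet A)
    (hB : MeasurableSet B) (h : Disjoint A B) :
    condIndicator m1 μ (A ∪ B) =ᵐ[μ] condIndicator m1 μ A + condIndicator m1 μ B := by
  rw [condIndicator, Set.indicator_union_of_disjoint h]
  exact condExp_add ((integrable_const 1).indicator hA) ((integrable_const 1).indicator hB) m1

theorem condIndicator_diff [IsFiniteMeasure μ] {A B : Set Ω} (hA : MeasurableSet A)
    (hB : MeasurableSet B) (h : B ⊆ A) :
    condIndicator m1 μ (A \ B) =ᵐ[μ] condIndicator m1 μ A - condIndicator m1 μ B := by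
  filter_upwards [condIndicator_union (m1 := m1) (μ := μ) hB (hA.diff hB)
    Set.disjoint_sdiff_right] with ω hω
  rw [Set.union_sdiff_cancel h] at hω
  simp only [Pi.add_apply, Pi.sub_apply] at *
  linarith

theorem condIndicator_mono [IsFiniteMeasure μ] {A B : Set Ω} (hA : MeasurableSet A)
    (hB : MeasurableSet B) (h : B ⊆ A) :
    condIndicator m1 μ B ≤ᵐ[μ] condIndicator m1 μ A := by
  filter_upwards [condIndicator_diff (m1 := m1) (μ := μ) hA hB h,
    condIndicator_nonneg (m1 := m1) (μ := μ) (A \ B)] with ω h1 h2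
  simp only [Pi.zero_apply, Pi.sub_apply] at *
  linarith

theorem condIndicator_le_one [IsFiniteMeasure μ] (hm : m1 ≤ m2) {A : Set Ω}
    (hA : MeasurableSet A) : condIndicator m1 μ A ≤ᵐ[μ] fun _ => 1 := by
  rw [← condIndicator_univ (μ := μ) hm]
  exact condIndicator_mono .univ hA (Set.subset_univ A)

theorem condIndicator_inter [IsFiniteMeasure μ] {A S : Set Ω} (hA : MeasurableSet A)
    (hS : MeasurableSet[m1] S) :
    condIndicator m1 μ (A ∩ S) =ᵐ[μ] S.indicator (condIndicator m1 μ A) := by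
  rw [condIndicator, Set.inter_comm, ← Set.indicator_indicator]
  exact condExp_indicator ((integrable_const 1).indicator hA) hS

/-- A conditionally atomless σ-algebra contains, inside every event, events of arbitrarily small
positive conditional probability. -/
theorem CondAtomless.exists_condIndicator_le_pow [IsFiniteMeasure μ] (hm : m1 ≤ m2)
    (hμ : CondAtomless m1 μ) {A : Set Ω} (hA : MeasurableSet A) (n : ℕ) :
    ∃ C, MeasurableSet C ∧ C ⊆ A ∧ ∀ᵐ ω ∂μ, 0 < condIndicator m1 μ A ω →
      0 < condIndicator m1 μ C ω ∧ condIndicator m1 μ C ω ≤ (1 / 2) ^ n := by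
  induction n with
  | zero =>
    refine ⟨A, hA, subset_rfl, ?_⟩
    filter_upwards [condIndicator_le_one (μ := μ) hm hA] with ω h1 h2
    exact ⟨h2, by simpa using h1⟩
  | succ n ih =>
    obtain ⟨C, hC, hCA, hCn⟩ := ih
    obtain ⟨B, hB, hBC, hBp⟩ := hμ C hC
    set T : Set Ω := {ω | 2 * condIndicator m1 μ B ω ≤ condIndicator m1 μ C ω}
    have hT : MeasurableSet[m1] T :=
      measurableSet_le ((measurable_condIndicator B).const_mul 2) (measurable_condIndicator C)
    refine ⟨B ∩ T ∪ (C \ B) ∩ Tᶜ, (hB.inter (hm _ hT)).union ((hC.diff hB).inter (hm _ hT.compl)),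
      Set.union_subset (Set.inter_subset_left.trans (hBC.trans hCA))
        (Set.inter_subset_left.trans (Set.sdiff_subset.trans hCA)), ?_⟩
    filter_upwards [hCn, hBp, condIndicator_diff (m1 := m1) (μ := μ) hC hB hBC,
      condIndicator_inter (μ := μ) hB hT, condIndicator_inter (μ := μ) (hC.diff hB) hT.compl,
      condIndicator_union (m1 := m1) (μ := μ) (hB.inter (hm _ hT))
        ((hC.diff hB).inter (hm _ hT.compl))
        (Set.disjoint_sdiff_right.mono Set.inter_subset_left Set.inter_subset_left)]
      with ω h1 h2 h3 h4 h5 h6 h7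
    obtain ⟨h8, h9⟩ := h1 h7
    obtain ⟨h10, h11⟩ := h2 h8
    simp only [Pi.add_apply, Pi.sub_apply] at h3 h6
    rw [h6, h4, h5, pow_succ]
    by_cases hω : ω ∈ T
    · have h12 : 2 * condIndicator m1 μ B ω ≤ condIndicator m1 μ C ω := hω
      rw [Set.indicator_of_mem hω, Set.indicator_of_notMem (by simpa using hω)]
      constructor <;> linarith
    · have h12 : ¬ 2 * condIndicator m1 μ B ω ≤ condIndicator m1 μ C ω := hω
      rw [Set.indicator_of_notMem hω, Set.indicator_of_mem (by simpa using hω), h3]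
      constructor <;> linarith

/-- Principle of exhaustion: a nonempty family of sets which is stable under increasing countable
unions has an element of maximal measure among its supersets. -/
theorem exists_forall_measureReal_le_of_iUnion [IsFiniteMeasure μ] {p : Set Ω → Prop} {B₀ : Set Ω}
    (h0 : p B₀) (hU : ∀ B : ℕ → Set Ω, Monotone B → (∀ n, p (B n)) → p (⋃ n, B n)) :
    ∃ B, p B ∧ ∀ B', p B' → B ⊆ B' → μ.real B' ≤ μ.real B := by
  have key (n : ℕ) (B : {B // p B}) : ∃ B' : {B // p B}, B.1 ⊆ B'.1 ∧
      ∀ B'', p B'' → B.1 ⊆ B'' → μ.real B'' ≤ μ.real B'.1 + 1 / (n + 1) := by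
    have hb : BddAbove ((fun B'' => μ.real B'') '' {B'' | p B'' ∧ B.1 ⊆ B''}) := by
      refine ⟨μ.real Set.univ, ?_⟩
      rintro _ ⟨B'', -, rfl⟩
      exact measureReal_mono (Set.subset_univ _)
    have hne : ((fun B'' => μ.real B'') '' {B'' | p B'' ∧ B.1 ⊆ B''}).Nonempty :=
      ⟨_, B.1, ⟨B.2, subset_rfl⟩, rfl⟩
    obtain ⟨_, ⟨B', ⟨hB', hBB'⟩, rfl⟩, hlt⟩ :=
      exists_lt_of_lt_csSup hne (sub_lt_self _ (Nat.one_div_pos_of_nat (α := ℝ) (n := n)))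
    refine ⟨⟨B', hB'⟩, hBB', fun B'' h h' => ?_⟩
    have := le_csSup hb ⟨B'', ⟨h, h'⟩, rfl⟩
    simp only at this hlt ⊢
    linarith
  choose F hF hF' using key
  let B : ℕ → {B // p B} := fun n => Nat.rec ⟨B₀, h0⟩ F n
  have hB : Monotone fun n => (B n).1 := monotone_nat_of_le_succ fun n => hF n (B n)
  refine ⟨⋃ n, (B n).1, hU _ hB fun n => (B n).2, fun B' h h' => ?_⟩
  refine le_of_forall_pos_le_add fun ε hε => ?_
  obtain ⟨n, hn⟩ := exists_nat_one_div_lt hε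
  have h1 := hF' n (B n) B' h ((Set.subset_iUnion (fun n => (B n).1) n).trans h')
  have h2 : μ.real (B (n + 1)).1 ≤ μ.real (⋃ n, (B n).1) :=
    measureReal_mono (Set.subset_iUnion (fun n => (B n).1) (n + 1))
  have h3 : B (n + 1) = F n (B n) := rfl
  rw [h3] at h2
  linarith

theorem condIndicator_smul_le_of_forall [IsFiniteMeasure μ] (hm : m1 ≤ m2) {A B : Set Ω} (c : ℝ)
    (hA : MeasurableSet A) (hB : MeasurableSet B)
    (h : ∀ S, MeasurableSet[m1] S → c * μ.real (B ∩ S) ≤ μ.real (A ∩ S)) :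
    ∀ᵐ ω ∂μ, c * condIndicator m1 μ B ω ≤ condIndicator m1 μ A ω := by
  have hi : Integrable (fun ω => c * condIndicator m1 μ B ω) μ :=
    (integrable_condIndicator B).const_mul c
  have hs : StronglyMeasurable[m1] fun ω => condIndicator m1 μ A ω - c * condIndicator m1 μ B ω :=
    (stronglyMeasurable_condIndicator A).sub ((stronglyMeasurable_condIndicator B).const_mul c)
  have key := ae_nonneg_of_forall_setIntegral_nonneg (μ := μ.trim hm)
    (f := fun ω => condIndicator m1 μ A ω - c * condIndicator m1 μ B ω)
    (((integrable_condIndicator A).sub hi).trim hm hs) fun S hS _ => by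
      rw [← setIntegral_trim hm hs hS,
        integral_sub (integrable_condIndicator A).integrableOn hi.integrableOn,
        integral_const_mul, setIntegral_condIndicator hm hA hS, setIntegral_condIndicator hm hB hS]
      linarith [h S hS]
  filter_upwards [ae_of_ae_trim hm key] with ω hω
  simpa using hω

theorem forall_of_condIndicator_smul_le [IsFiniteMeasure μ] (hm : m1 ≤ m2) {A B : Set Ω} {c : ℝ}
    (hA : MeasurableSet A) (hB : MeasurableSet B)
    (h : ∀ᵐ ω ∂μ, c * condIndicator m1 μ B ω ≤ condIndicator m1 μ A ω)
    {S : Set Ω} (hS : MeasurableSet[m1] S) : c * μ.real (B ∩ S) ≤ μ.real (A ∩ S) := by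
  rw [← setIntegral_condIndicator hm hA hS, ← setIntegral_condIndicator hm hB hS,
    ← integral_const_mul]
  exact setIntegral_mono_ae ((integrable_condIndicator B).const_mul c).integrableOn
    (integrable_condIndicator A).integrableOn h

/-- If `A` is conditionally strictly more likely than twice `B ⊆ A` on a non-null event, then `B`
can be enlarged inside `A` without making it conditionally more likely than half of `A`. -/
theorem CondAtomless.exists_superset_of_not_ae [IsFiniteMeasure μ] (hm : m1 ≤ m2)
    (hμ : CondAtomless m1 μ) {A B : Set Ω} (hA : MeasurableSet A) (hB : MeasurableSet B)
    (hBA : B ⊆ A) (hle : ∀ᵐ ω ∂μ, 2 * condIndicator m1 μ B ω ≤ condIndicator m1 μ A ω)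
    (hne : ¬ ∀ᵐ ω ∂μ, 2 * condIndicator m1 μ B ω = condIndicator m1 μ A ω) :
    ∃ B', MeasurableSet B' ∧ B ⊆ B' ∧ B' ⊆ A ∧ μ.real B < μ.real B' ∧
      ∀ᵐ ω ∂μ, 2 * condIndicator m1 μ B' ω ≤ condIndicator m1 μ A ω := by
  set D : ℕ → Set Ω := fun n =>
    {ω | 2 * condIndicator m1 μ B ω + 2 * (1 / 2) ^ n ≤ condIndicator m1 μ A ω} with hD
  have hDm (n : ℕ) : MeasurableSet[m1] (D n) :=
    measurableSet_le (((measurable_condIndicator B).const_mul 2).add_const _)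
      (measurable_condIndicator A)
  obtain ⟨n, hn⟩ : ∃ n, μ (D n) ≠ 0 := by
    by_contra! h
    refine hne ?_
    filter_upwards [hle, ae_all_iff.2 fun n => measure_eq_zero_iff_ae_notMem.1 (h n)]
      with ω h1 h2
    refine h1.antisymm (le_of_not_gt fun hlt => ?_)
    obtain ⟨n, hn⟩ := exists_pow_lt_of_lt_one
      (show 0 < (condIndicator m1 μ A ω - 2 * condIndicator m1 μ B ω) / 2 by linarith)
      (show (1 / 2 : ℝ) < 1 by norm_num)
    refine h2 n ?_
    simp only [hD, Set.mem_ofPred_eq]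
    linarith
  obtain ⟨C, hC, hCA, hCn⟩ := hμ.exists_condIndicator_le_pow hm (hA.diff hB) n
  have hCD : MeasurableSet (C ∩ D n) := hC.inter (hm _ (hDm n))
  have hdisj : Disjoint B (C ∩ D n) :=
    Set.disjoint_sdiff_right.mono_right (Set.inter_subset_left.trans hCA)
  have hpos : ∀ᵐ ω ∂μ, ω ∈ D n →
      0 < condIndicator m1 μ C ω ∧ condIndicator m1 μ C ω ≤ (1 / 2) ^ n := by
    filter_upwards [hCn, condIndicator_diff (m1 := m1) (μ := μ) hA hB hBA,
      condIndicator_nonneg (m1 := m1) (μ := μ) B] with ω h1 h2 h3 h4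
    refine h1 ?_
    have h5 : 2 * condIndicator m1 μ B ω + 2 * (1 / 2) ^ n ≤ condIndicator m1 μ A ω := h4
    have h6 : (0 : ℝ) < (1 / 2) ^ n := by positivity
    simp only [Pi.sub_apply, Pi.zero_apply] at h2 h3
    rw [h2]
    linarith
  refine ⟨B ∪ (C ∩ D n), hB.union hCD, Set.subset_union_left,
    Set.union_subset hBA (Set.inter_subset_left.trans (hCA.trans Set.sdiff_subset)), ?_, ?_⟩
  · rw [measureReal_union hdisj hCD, ← setIntegral_condIndicator hm hC (hDm n)]
    refine lt_add_of_pos_right _ ?_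
    rw [setIntegral_pos_iff_support_of_nonneg_ae (ae_restrict_of_ae (condIndicator_nonneg C))
      (integrable_condIndicator C).integrableOn]
    refine (pos_iff_ne_zero.2 hn).trans_le (measure_mono_ae ?_)
    filter_upwards [hpos] with ω h1 h2
    exact ⟨(h1 h2).1.ne', h2⟩
  · filter_upwards [hpos, hle, condIndicator_union (m1 := m1) (μ := μ) hB hCD hdisj,
      condIndicator_inter (μ := μ) hC (hDm n)] with ω h1 h2 h3 h4
    simp only [Pi.add_apply] at h3
    rw [h3, h4]
    by_cases hω : ω ∈ D n
    · rw [Set.indicator_of_mem hω]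
      have h5 : 2 * condIndicator m1 μ B ω + 2 * (1 / 2) ^ n ≤ condIndicator m1 μ A ω := hω
      linarith [h1 hω]
    · rw [Set.indicator_of_notMem hω]
      linarith

/-- Inside every event of a conditionally atomless σ-algebra there is an event which is
conditionally half as likely. -/
theorem CondAtomless.exists_half [IsFiniteMeasure μ] (hm : m1 ≤ m2) (hμ : CondAtomless m1 μ)
    {A : Set Ω} (hA : MeasurableSet A) :
    ∃ B, MeasurableSet B ∧ B ⊆ A ∧
      ∀ S, MeasurableSet[m1] S → 2 * μ.real (B ∩ S) = μ.real (A ∩ S) := by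
  obtain ⟨B, ⟨hB, hBA, hle⟩, hmax⟩ := exists_forall_measureReal_le_of_iUnion (μ := μ)
    (p := fun B => MeasurableSet B ∧ B ⊆ A ∧
      ∀ S, MeasurableSet[m1] S → 2 * μ.real (B ∩ S) ≤ μ.real (A ∩ S))
    (B₀ := ∅) ⟨.empty, Set.empty_subset A, fun S _ => by simp⟩ fun B hmono hB => by
      refine ⟨.iUnion fun n => (hB n).1, Set.iUnion_subset fun n => (hB n).2.1, fun S hS => ?_⟩
      have hlim : Filter.Tendsto (fun n => μ.real (B n ∩ S)) Filter.atTop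
          (nhds (μ.real ((⋃ n, B n) ∩ S))) := by
        rw [Set.iUnion_inter]
        exact (ENNReal.tendsto_toReal (measure_ne_top _ _)).comp
          (tendsto_measure_iUnion_atTop fun i j hij => Set.inter_subset_inter_left S (hmono hij))
      exact le_of_tendsto (hlim.const_mul 2) (.of_forall fun n => (hB n).2.2 S hS)
  refine ⟨B, hB, hBA, fun S hS => ?_⟩
  have hle' := condIndicator_smul_le_of_forall hm 2 hA hB hle
  by_cases heq : ∀ᵐ ω ∂μ, 2 * condIndicator m1 μ B ω = condIndicator m1 μ A ω
  · rw [← setIntegral_condIndicator hm hA hS, ← setIntegral_condIndicator hm hB hS,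
      ← integral_const_mul]
    exact integral_congr_ae (ae_restrict_of_ae heq)
  · obtain ⟨B', hB', hBB', hBA', hlt, hle''⟩ := hμ.exists_superset_of_not_ae hm hA hB hBA hle' heq
    exact absurd (hmax B' ⟨hB', hBA', fun S hS =>
      forall_of_condIndicator_smul_le hm hA hB' hle'' hS⟩ hBB') hlt.not_ge

theorem measurableSet_dyadicChain {L : Set Ω → Set Ω}
    (hL : ∀ A, MeasurableSet A → MeasurableSet (L A)) (n k : ℕ) :
    MeasurableSet (dyadicChain L n k) := by
  induction n generalizing k with
  | zero =>
    unfold dyadicChain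
    split_ifs <;> simp
  | succ n ih =>
    unfold dyadicChain
    split_ifs
    exacts [ih _, (ih _).union (hL _ ((ih _).diff (ih _)))]

theorem measureReal_dyadicChain_inter [IsFiniteMeasure μ] {L : Set Ω → Set Ω}
    (hL : ∀ A, L A ⊆ A) (hLm : ∀ A, MeasurableSet A → MeasurableSet (L A)) {S : Set Ω}
    (hS : MeasurableSet S)
    (hLS : ∀ A, MeasurableSet A → 2 * μ.real (L A ∩ S) = μ.real (A ∩ S)) (n k : ℕ) :
    2 ^ n * μ.real (dyadicChain L n k ∩ S) = (min k (2 ^ n) : ℕ) * μ.real S := by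
  induction n generalizing k with
  | zero =>
    rcases k with _ | k <;> simp [dyadicChain]
  | succ n ih =>
    obtain ⟨j, rfl | rfl⟩ := k.even_or_odd'
    · have h1 : min (2 * j) (2 ^ (n + 1)) = 2 * min j (2 ^ n) := by
        rw [pow_succ']
        omega
      rw [dyadicChain_succ_two_mul, pow_succ', mul_assoc, ih, h1]
      push_cast
      ring
    · have hD := measurableSet_dyadicChain hLm n
      have hsub : dyadicChain L n j ⊆ dyadicChain L n (j + 1) :=
        monotone_dyadicChain hL n j.le_succ
      have h1 : μ.real (dyadicChain L (n + 1) (2 * j + 1) ∩ S) = μ.real (dyadicChain L n j ∩ S) +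
          μ.real (L (dyadicChain L n (j + 1) \ dyadicChain L n j) ∩ S) := by
        rw [dyadicChain_succ_two_mul_add_one, Set.union_inter_distrib_right]
        refine measureReal_union ?_ ((hLm _ ((hD _).diff (hD _))).inter hS)
        exact Set.disjoint_sdiff_right.mono Set.inter_subset_left
          (Set.inter_subset_left.trans (hL _))
      have h2 : μ.real (dyadicChain L n (j + 1) ∩ S) = μ.real (dyadicChain L n j ∩ S) +
          μ.real ((dyadicChain L n (j + 1) \ dyadicChain L n j) ∩ S) := by
        rw [← measureReal_union (Set.disjoint_sdiff_right.mono Set.inter_subset_left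
          Set.inter_subset_left) (((hD _).diff (hD _)).inter hS), ← Set.union_inter_distrib_right,
          Set.union_sdiff_cancel hsub]
      have h3 := hLS _ ((hD (j + 1)).diff (hD j))
      have h4 : min (2 * j + 1) (2 ^ (n + 1)) = min j (2 ^ n) + min (j + 1) (2 ^ n) := by
        rw [pow_succ']
        omega
      rw [h4, h1]
      push_cast
      have h5 := ih j
      have h6 := ih (j + 1)
      push_cast at h5 h6
      rw [add_mul, ← h5, ← h6, h2, ← h3]
      ring

theorem measurable_dyadicVar {L : Set Ω → Set Ω}
    (hL : ∀ A, MeasurableSet A → MeasurableSet (L A)) : Measurable (dyadicVar L) :=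
  .iInf fun p => .ite (measurableSet_dyadicChain hL p.1 p.2) measurable_const measurable_const

theorem measureReal_dyadicVar_le_inter [IsProbabilityMeasure μ] {L : Set Ω → Set Ω}
    (hL : ∀ A, L A ⊆ A) (hLm : ∀ A, MeasurableSet A → MeasurableSet (L A)) {S : Set Ω}
    (hS : MeasurableSet S)
    (hLS : ∀ A, MeasurableSet A → 2 * μ.real (L A ∩ S) = μ.real (A ∩ S)) {t : ℝ}
    (ht : t ∈ Set.Icc (0 : ℝ) 1) : μ.real ({ω | dyadicVar L ω ≤ t} ∩ S) = t * μ.real S := by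
  obtain rfl | ht1 := ht.2.eq_or_lt
  · have h : {ω | dyadicVar L ω ≤ 1} = Set.univ :=
      Set.eq_univ_of_forall fun ω => (dyadicVar_mem_Icc L ω).2
    rw [h, Set.univ_inter, one_mul]
  have hS1 : μ.real S ≤ 1 := measureReal_le_one
  have hS0 : 0 ≤ μ.real S := measureReal_nonneg
  have key (n : ℕ) : |μ.real ({ω | dyadicVar L ω ≤ t} ∩ S) - t * μ.real S| ≤ (1 / 2) ^ n := by
    have h2 : (0 : ℝ) < 2 ^ n := by positivity
    have ht0 : 0 ≤ t * 2 ^ n := mul_nonneg ht.1 h2.le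
    set k := ⌊t * 2 ^ n⌋₊
    have hk : (k : ℝ) ≤ t * 2 ^ n := Nat.floor_le ht0
    have hk' : t * 2 ^ n < k + 1 := Nat.lt_floor_add_one _
    have hk1 : k + 1 ≤ 2 ^ n := by
      have : (k : ℝ) < (2 ^ n : ℕ) := by
        push_cast
        nlinarith
      exact Nat.succ_le_of_lt (by exact_mod_cast this)
    have hsub : dyadicChain L n k ⊆ {ω | dyadicVar L ω ≤ t} := fun ω hω =>
      (dyadicVar_le_of_mem hω).trans ((div_le_iff₀ h2).2 hk)
    have hsub' : {ω | dyadicVar L ω ≤ t} ⊆ dyadicChain L n (k + 1) := fun ω hω =>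
      mem_dyadicChain_of_dyadicVar_lt hL hk1
        (lt_of_le_of_lt hω ((lt_div_iff₀ h2).2 (by exact_mod_cast hk')))
    have h3 := measureReal_dyadicChain_inter hL hLm hS hLS n k
    have h4 := measureReal_dyadicChain_inter hL hLm hS hLS n (k + 1)
    rw [min_eq_left (by omega)] at h3 h4
    have h5 : μ.real (dyadicChain L n k ∩ S) ≤ μ.real ({ω | dyadicVar L ω ≤ t} ∩ S) :=
      measureReal_mono (Set.inter_subset_inter_left S hsub)
    have h6 : μ.real ({ω | dyadicVar L ω ≤ t} ∩ S) ≤ μ.real (dyadicChain L n (k + 1) ∩ S) :=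
      measureReal_mono (Set.inter_subset_inter_left S hsub')
    push_cast at h4
    have h7 : |(μ.real ({ω | dyadicVar L ω ≤ t} ∩ S) - t * μ.real S) * 2 ^ n| ≤ 1 := by
      rw [abs_le]
      constructor <;> nlinarith
    rwa [abs_mul, abs_of_pos h2, ← le_div_iff₀ h2, ← one_div_pow] at h7
  have hlim := tendsto_pow_atTop_nhds_zero_of_lt_one (r := (1 / 2 : ℝ)) (by norm_num) (by norm_num)
  have h0 := ge_of_tendsto' hlim key
  exact sub_eq_zero.1 (abs_eq_zero.1 (h0.antisymm (abs_nonneg _)))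

/-- A conditionally atomless σ-algebra carries a random variable with values in the unit interval
whose conditional distribution function is the identity. -/
theorem CondAtomless.exists_measureReal_le_inter [IsProbabilityMeasure μ] (hm : m1 ≤ m2)
    (hμ : CondAtomless m1 μ) :
    ∃ U : Ω → ℝ, Measurable U ∧ (∀ ω, U ω ∈ Set.Icc (0 : ℝ) 1) ∧
      ∀ t ∈ Set.Icc (0 : ℝ) 1, ∀ S, MeasurableSet[m1] S →
        μ.real ({ω | U ω ≤ t} ∩ S) = t * μ.real S := by
  have hex (A : Set Ω) : ∃ B ⊆ A, MeasurableSet A → MeasurableSet B ∧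
      ∀ S, MeasurableSet[m1] S → 2 * μ.real (B ∩ S) = μ.real (A ∩ S) := by
    by_cases hA : MeasurableSet A
    · obtain ⟨B, hB, hBA, h⟩ := hμ.exists_half hm hA
      exact ⟨B, hBA, fun _ => ⟨hB, h⟩⟩
    · exact ⟨∅, Set.empty_subset A, fun h => absurd h hA⟩
  choose L hL hL' using hex
  have hLm (A : Set Ω) (hA : MeasurableSet A) : MeasurableSet (L A) := (hL' A hA).1
  exact ⟨dyadicVar L, measurable_dyadicVar hLm, dyadicVar_mem_Icc L, fun t ht S hS =>
    measureReal_dyadicVar_le_inter hL hLm (hm S hS) (fun A hA => (hL' A hA).2 S hS) ht⟩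

theorem map_eq_restrict_Icc_of_measureReal_le [IsProbabilityMeasure μ] {U : Ω → ℝ}
    (hU : Measurable U) (hU01 : ∀ ω, U ω ∈ Set.Icc (0 : ℝ) 1)
    (h : ∀ t ∈ Set.Icc (0 : ℝ) 1, μ.real {ω | U ω ≤ t} = t) :
    μ.map U = (volume : Measure ℝ).restrict (Set.Icc 0 1) := by
  have : IsProbabilityMeasure (μ.map U) := Measure.isProbabilityMeasure_map hU.aemeasurable
  refine Measure.ext_of_Iic _ _ fun t => ?_
  rw [Measure.map_apply hU measurableSet_Iic, Measure.restrict_apply measurableSet_Iic]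
  rcases lt_or_ge t 0 with ht | ht
  · have h1 : U ⁻¹' Set.Iic t = ∅ := by
      ext ω
      simpa using ht.trans_le (hU01 ω).1
    have h2 : Set.Iic t ∩ Set.Icc (0 : ℝ) 1 = ∅ := by
      ext x
      simp only [Set.mem_inter_iff, Set.mem_Iic, Set.mem_Icc, Set.mem_empty_iff_false, iff_false]
      intro hx
      linarith [hx.1, hx.2.1]
    simp [h1, h2]
  rcases le_or_gt t 1 with ht1 | ht1
  · have h2 : Set.Iic t ∩ Set.Icc (0 : ℝ) 1 = Set.Icc 0 t := by
      ext x
      simp only [Set.mem_inter_iff, Set.mem_Iic, Set.mem_Icc]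
      exact ⟨fun hx => ⟨hx.2.1, hx.1⟩, fun hx => ⟨hx.2, hx.1, hx.2.trans ht1⟩⟩
    have h3 : μ.real (U ⁻¹' Set.Iic t) = t := h t ⟨ht, ht1⟩
    rw [h2, Real.volume_Icc, sub_zero, ← ofReal_measureReal, h3]
  · have h1 : U ⁻¹' Set.Iic t = Set.univ :=
      Set.eq_univ_of_forall fun ω => (hU01 ω).2.trans ht1.le
    have h2 : Set.Iic t ∩ Set.Icc (0 : ℝ) 1 = Set.Icc 0 1 :=
      Set.inter_eq_right.2 fun x hx => hx.2.trans ht1.le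
    simp [h1, h2]

theorem indep_comap_of_measureReal_le_inter [IsProbabilityMeasure μ] (hm : m1 ≤ m2) {U : Ω → ℝ}
    (hU : Measurable U) (hU01 : ∀ ω, U ω ∈ Set.Icc (0 : ℝ) 1)
    (h : ∀ t ∈ Set.Icc (0 : ℝ) 1, ∀ S, MeasurableSet[m1] S →
      μ.real ({ω | U ω ≤ t} ∩ S) = t * μ.real S) :
    Indep (MeasurableSpace.comap U inferInstance) m1 μ := by
  refine IndepSets.indep hU.comap_le hm (isPiSystem_Iic.comap U)
    (@MeasurableSpace.isPiSystem_measurableSet Ω m1) ?_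
    (@MeasurableSpace.generateFrom_measurableSet Ω m1).symm ?_
  · rw [(BorelSpace.measurable_eq (α := ℝ)), borel_eq_generateFrom_Iic ℝ,
      MeasurableSpace.comap_generateFrom]
    rfl
  refine (IndepSets_iff _ _ _).2 ?_
  rintro _ S ⟨_, ⟨t, rfl⟩, rfl⟩ hS
  rcases lt_or_ge t 0 with ht | ht
  · have h1 : U ⁻¹' Set.Iic t = ∅ := by
      ext ω
      simpa using ht.trans_le (hU01 ω).1
    simp [h1]
  rcases le_or_gt t 1 with ht1 | ht1
  · have h1 : μ.real (U ⁻¹' Set.Iic t ∩ S) = t * μ.real S := h t ⟨ht, ht1⟩ S hS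
    have h2 : μ.real (U ⁻¹' Set.Iic t) = t := by
      simpa [Set.preimage] using h t ⟨ht, ht1⟩ Set.univ .univ
    rw [← ofReal_measureReal, ← ofReal_measureReal (s := U ⁻¹' Set.Iic t),
      ← ofReal_measureReal (s := S), ← ENNReal.ofReal_mul measureReal_nonneg, h1, h2]
  · have h1 : U ⁻¹' Set.Iic t = Set.univ :=
      Set.eq_univ_of_forall fun ω => (hU01 ω).2.trans ht1.le
    simp [h1]

theorem IndepFun.measureReal_le_comp_inter_preimage [IsProbabilityMeasure μ] {β : Type*}
    [MeasurableSpace β] {U : Ω → ℝ} {X : Ω → β} (hU : Measurable U) (hX : Measurable X)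
    (hUX : IndepFun U X μ) (hlaw : μ.map U = (volume : Measure ℝ).restrict (Set.Icc 0 1))
    {h : β → ℝ} (hh : Measurable h) (h01 : ∀ x, h x ∈ Set.Icc (0 : ℝ) 1) {T : Set β}
    (hT : MeasurableSet T) :
    μ.real ({ω | U ω ≤ h (X ω)} ∩ X ⁻¹' T) = ∫ ω in X ⁻¹' T, h (X ω) ∂μ := by
  have hE : MeasurableSet {p : ℝ × β | p.1 ≤ h p.2 ∧ p.2 ∈ T} :=
    (measurableSet_le measurable_fst (hh.comp measurable_snd)).inter (measurable_snd hT)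
  have h1 : μ ({ω | U ω ≤ h (X ω)} ∩ X ⁻¹' T) =
      μ.map (fun ω => (U ω, X ω)) {p | p.1 ≤ h p.2 ∧ p.2 ∈ T} := by
    rw [Measure.map_apply (hU.prodMk hX) hE]
    rfl
  have h2 (x : β) : μ.map U ((fun u => (u, x)) ⁻¹' {p : ℝ × β | p.1 ≤ h p.2 ∧ p.2 ∈ T}) =
      T.indicator (fun x => ENNReal.ofReal (h x)) x := by
    by_cases hx : x ∈ T
    · have h3 : (fun u => (u, x)) ⁻¹' {p : ℝ × β | p.1 ≤ h p.2 ∧ p.2 ∈ T} = Set.Iic (h x) := by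
        ext u
        simp [hx]
      have h4 : Set.Iic (h x) ∩ Set.Icc (0 : ℝ) 1 = Set.Icc 0 (h x) := by
        ext u
        simp only [Set.mem_inter_iff, Set.mem_Iic, Set.mem_Icc]
        exact ⟨fun hu => ⟨hu.2.1, hu.1⟩, fun hu => ⟨hu.2, hu.1, hu.2.trans (h01 x).2⟩⟩
      rw [h3, hlaw, Measure.restrict_apply measurableSet_Iic, h4, Real.volume_Icc, sub_zero,
        Set.indicator_of_mem hx]
    · simp [hx]
  rw [integral_eq_lintegral_of_nonneg_ae (.of_forall fun ω => (h01 (X ω)).1)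
    (hh.comp hX).aestronglyMeasurable, measureReal_def, h1, hUX.map_prod_eq_prod_map_map
    hU.aemeasurable hX.aemeasurable, Measure.prod_apply_symm hE, lintegral_congr h2,
    lintegral_indicator hT, setLIntegral_map hT hh.ennreal_ofReal hX]

theorem condIndicator_le_ae_eq [IsProbabilityMeasure μ] (hm : m1 ≤ m2) {U : Ω → ℝ}
    (hU : Measurable U) (hlaw : μ.map U = (volume : Measure ℝ).restrict (Set.Icc 0 1))
    (hind : Indep (MeasurableSpace.comap U inferInstance) m1 μ) {h : Ω → ℝ}
    (hh : Measurable[m1] h) (h01 : ∀ ω, h ω ∈ Set.Icc (0 : ℝ) 1) :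
    condIndicator m1 μ {ω | U ω ≤ h ω} =ᵐ[μ] h := by
  have hE : MeasurableSet {ω | U ω ≤ h ω} := measurableSet_le hU (hh.mono hm le_rfl)
  have hid : @IndepFun Ω ℝ Ω m2 inferInstance m1 U id μ := by
    refine (@IndepFun_iff_Indep Ω ℝ Ω m2 inferInstance m1 U id μ).2 ?_
    rwa [MeasurableSpace.comap_id]
  have hint : Integrable h μ :=
    .of_bound (hh.mono hm le_rfl).aestronglyMeasurable 1 (.of_forall fun ω => by
      rw [Real.norm_of_nonneg (h01 ω).1]
      exact (h01 ω).2)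
  refine (ae_eq_condExp_of_forall_setIntegral_eq hm ((integrable_const 1).indicator hE)
    (fun S _ _ => hint.integrableOn) (fun S hS _ => ?_)
    ⟨h, hh.stronglyMeasurable, .rfl⟩).symm
  rw [integral_indicator hE, Measure.restrict_restrict hE]
  simpa using (@IndepFun.measureReal_le_comp_inter_preimage Ω m2 μ _ Ω m1 U id hU
    (measurable_id'' hm) hid hlaw h hh h01 S hS).symm

/-- Sets can be glued along conditions measurable for the smaller σ-algebra: if almost surely one
of countably many subsets of `A` has conditional probability strictly between zero and that of
`A`, then a single subset of `A` does. -/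
theorem exists_condIndicator_lt_of_iUnion [IsFiniteMeasure μ] (hm : m1 ≤ m2) {A : Set Ω}
    {B : ℕ → Set Ω} (hB : ∀ i, MeasurableSet (B i)) (hBA : ∀ i, B i ⊆ A)
    (h : ∀ᵐ ω ∂μ, 0 < condIndicator m1 μ A ω →
      ∃ i, 0 < condIndicator m1 μ (B i) ω ∧ condIndicator m1 μ (B i) ω < condIndicator m1 μ A ω) :
    ∃ C, MeasurableSet C ∧ C ⊆ A ∧ ∀ᵐ ω ∂μ, 0 < condIndicator m1 μ A ω →
      0 < condIndicator m1 μ C ω ∧ condIndicator m1 μ C ω < condIndicator m1 μ A ω := by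
  set T : ℕ → Set Ω := fun i =>
    {ω | 0 < condIndicator m1 μ (B i) ω ∧ condIndicator m1 μ (B i) ω < condIndicator m1 μ A ω}
  have hT (i : ℕ) : MeasurableSet[m1] (T i) :=
    (measurableSet_lt measurable_const (measurable_condIndicator _)).inter
      (measurableSet_lt (measurable_condIndicator _) (measurable_condIndicator _))
  have hT' (i : ℕ) : MeasurableSet[m1] (disjointed T i) := @MeasurableSet.disjointed Ω m1 T hT i
  have hC : MeasurableSet (⋃ i, B i ∩ disjointed T i) :=
    .iUnion fun i => (hB i).inter (hm _ (hT' i))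
  have hinter (i : ℕ) :
      (⋃ j, B j ∩ disjointed T j) ∩ disjointed T i = B i ∩ disjointed T i := by
    ext ω
    simp only [Set.mem_inter_iff, Set.mem_iUnion]
    constructor
    · rintro ⟨⟨j, hj, hj'⟩, hi⟩
      obtain rfl : j = i := by
        by_contra hne
        exact Set.disjoint_left.1 (disjoint_disjointed T hne) hj' hi
      exact ⟨hj, hi⟩
    · exact fun hω => ⟨⟨i, hω⟩, hω.2⟩
  refine ⟨_, hC, Set.iUnion_subset fun i => Set.inter_subset_left.trans (hBA i), ?_⟩
  filter_upwards [h, ae_all_iff.2 fun i => condIndicator_inter (μ := μ) hC (hT' i),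
    ae_all_iff.2 fun i => condIndicator_inter (μ := μ) (hB i) (hT' i)] with ω h1 h2 h3 h4
  have h5 : ω ∈ ⋃ i, disjointed T i := by
    rw [iUnion_disjointed]
    exact Set.mem_iUnion.2 (h1 h4)
  obtain ⟨i, hi⟩ := Set.mem_iUnion.1 h5
  have h6 := h2 i
  rw [hinter i, h3 i, Set.indicator_of_mem hi, Set.indicator_of_mem hi] at h6
  rw [← h6]
  exact disjointed_subset T i hi

theorem condIndicator_inter_le_add [IsFiniteMeasure μ] {U : Ω → ℝ} (hU : Measurable U)
    (h : ∀ t ∈ Set.Icc (0 : ℝ) 1, condIndicator m1 μ {ω | U ω ≤ t} =ᵐ[μ] fun _ => t) {A : Set Ω}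
    (hA : MeasurableSet A) {s t : ℝ} (hs : 0 ≤ s) (hst : s ≤ t) (ht : t ≤ 1) :
    ∀ᵐ ω ∂μ, condIndicator m1 μ (A ∩ {ω | U ω ≤ t}) ω ≤
      condIndicator m1 μ (A ∩ {ω | U ω ≤ s}) ω + (t - s) := by
  have hE (r : ℝ) : MeasurableSet {ω | U ω ≤ r} := measurableSet_le hU measurable_const
  have hsub : {ω | U ω ≤ s} ⊆ {ω | U ω ≤ t} := fun ω hω => le_trans hω hst
  have hD := (hE t).diff (hE s)
  filter_upwards [h s ⟨hs, hst.trans ht⟩, h t ⟨hs.trans hst, ht⟩,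
    condIndicator_diff (m1 := m1) (μ := μ) (hE t) (hE s) hsub,
    condIndicator_diff (m1 := m1) (μ := μ) (hA.inter (hE t)) (hA.inter (hE s))
      (Set.inter_subset_inter_right A hsub),
    condIndicator_mono (m1 := m1) (μ := μ) hD ((hA.inter (hE t)).diff (hA.inter (hE s)))
      fun ω hω => ⟨hω.1.2, fun hω' => hω.2 ⟨hω.1.1, hω'⟩⟩] with ω h1 h2 h3 h4 h5
  simp only [Pi.sub_apply] at h3 h4
  linarith

theorem condAtomless_of_condIndicator_le [IsFiniteMeasure μ] (hm : m1 ≤ m2) {U : Ω → ℝ}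
    (hU : Measurable U) (hU01 : ∀ ω, U ω ∈ Set.Icc (0 : ℝ) 1)
    (h : ∀ t ∈ Set.Icc (0 : ℝ) 1, condIndicator m1 μ {ω | U ω ≤ t} =ᵐ[μ] fun _ => t) :
    CondAtomless m1 μ := by
  intro A hA
  have hE (r : ℝ) : MeasurableSet {ω | U ω ≤ r} := measurableSet_le hU measurable_const
  set B : ℕ → ℕ → Set Ω := fun n k => A ∩ {ω | U ω ≤ k / (n + 1)}
  have hB (n k : ℕ) : MeasurableSet (B n k) := hA.inter (hE _)
  have hstep (n k : ℕ) : ∀ᵐ ω ∂μ, k + 1 ≤ n + 1 → condIndicator m1 μ (B n (k + 1)) ω ≤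
      condIndicator m1 μ (B n k) ω + 1 / (n + 1) := by
    by_cases hk : k + 1 ≤ n + 1
    · have hk' : ((k + 1 : ℕ) : ℝ) ≤ n + 1 := by exact_mod_cast hk
      have hn : (0 : ℝ) < n + 1 := by positivity
      filter_upwards [condIndicator_inter_le_add hU h hA (s := k / (n + 1))
        (t := (k + 1 : ℕ) / (n + 1)) (by positivity)
        (div_le_div_of_nonneg_right (by simp) hn.le) ((div_le_one hn).2 hk')] with ω hω _
      refine hω.trans_eq ?_
      push_cast
      ring
    · exact .of_forall fun ω hω => absurd hω hk
  have hzero (n : ℕ) : ∀ᵐ ω ∂μ, condIndicator m1 μ (B n 0) ω ≤ 0 := by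
    filter_upwards [h 0 ⟨le_rfl, zero_le_one⟩,
      condIndicator_mono (m1 := m1) (μ := μ) (hE 0) (hB n 0) fun ω hω => by
        simpa [B] using hω.2] with ω h1 h2
    exact h2.trans_eq h1
  have htop (n : ℕ) : B n (n + 1) = A := by
    refine Set.inter_eq_left.2 fun ω _ => (hU01 ω).2.trans_eq ?_
    push_cast
    rw [div_self (by positivity)]
  refine exists_condIndicator_lt_of_iUnion hm (B := fun i => B i.unpair.1 i.unpair.2)
    (fun i => hB _ _) (fun i => Set.inter_subset_left) ?_
  filter_upwards [ae_all_iff.2 fun n => ae_all_iff.2 (hstep n), ae_all_iff.2 hzero]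
    with ω h1 h2 h3
  obtain ⟨n, hn⟩ := exists_nat_one_div_lt h3
  have hex : ∃ k, 0 < condIndicator m1 μ (B n k) ω := ⟨n + 1, by rwa [htop]⟩
  classical
  have hle : Nat.find hex ≤ n + 1 := Nat.find_min' hex (by rwa [htop])
  have hpos := Nat.find_spec hex
  obtain ⟨k, hk⟩ : ∃ k, Nat.find hex = k + 1 := by
    refine Nat.exists_eq_succ_of_ne_zero fun h0 => ?_
    rw [h0] at hpos
    exact hpos.not_ge (h2 n)
  have hlt := Nat.find_min hex (m := k) (by omega)
  rw [hk] at hpos hle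
  refine ⟨Nat.pair n (k + 1), ?_⟩
  simp only [Nat.unpair_pair]
  exact ⟨hpos, by linarith [h1 n k hle]⟩

end CondIndicator

theorem condAtomless_iff_exists_uniform_section {Ω : Type*} (m1 : MeasurableSpace Ω)
    [m2 : MeasurableSpace Ω] (hm : m1 ≤ m2) (μ : Measure Ω) [IsProbabilityMeasure μ] :
    CondAtomless m1 μ ↔
      ∃ U : Ω → ℝ, Measurable U ∧ (∀ ω, U ω ∈ Set.Icc (0 : ℝ) 1) ∧
        μ.map U = (volume : Measure ℝ).restrict (Set.Icc 0 1) ∧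
        @Indep Ω (MeasurableSpace.comap U inferInstance) m1 m2 μ ∧
        ∀ h : Ω → ℝ, Measurable[m1] h → (∀ ω, h ω ∈ Set.Icc (0 : ℝ) 1) →
          condIndicator m1 μ {ω | U ω ≤ h ω} =ᵐ[μ] h := by
  constructor
  · intro hμ
    obtain ⟨U, hU, hU01, h⟩ := hμ.exists_measureReal_le_inter hm
    have hlaw := map_eq_restrict_Icc_of_measureReal_le (μ := μ) hU hU01 fun t ht => by
      simpa using h t ht Set.univ .univ
    have hind := indep_comap_of_measureReal_le_inter hm hU hU01 h
    exact ⟨U, hU, hU01, hlaw, hind, fun g hg hg01 =>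
      condIndicator_le_ae_eq hm hU hlaw hind hg hg01⟩
  · rintro ⟨U, hU, hU01, -, -, h⟩
    exact condAtomless_of_condIndicator_le hm hU hU01 fun t ht =>
      h (fun _ => t) measurable_const fun _ => ht
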